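/- Let x̄ ∉ Ω with T(x̄) < ∞, and let ε ≥ 0. Then every ε-subgradient x* ∈ ∂̂_ε T(x̄) satisfies the two-sided estimate 1 − ε·‖F‖ ≤ σ_F(−x*) ≤ 1 + ε·‖F‖. -/

import Mathlib

open Set Filter Topology Pointwise
open scoped ENNReal

variable {X : Type*}

/-- Minimal time function `T(x) = inf{t ≥ 0 : Ω ∩ (x + tF) ≠ ∅}`, with `inf ∅ = ∞`. -/
noncomputable def mtime [NormedAddCommGroup X] [NormedSpace ℝ X]
    (Ω F : Set X) (x : X) : ℝ≥0∞ :=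
  ⨅ (t : ℝ) (_ : 0 ≤ t ∧ ∃ q ∈ F, x + t • q ∈ Ω), ENNReal.ofReal t

/-- Minkowski gauge `ρ_F(u) = inf{t ≥ 0 : u ∈ tF}`, with `inf ∅ = ∞`. -/
noncomputable def mgauge [NormedAddCommGroup X] [NormedSpace ℝ X]
    (F : Set X) (u : X) : ℝ≥0∞ :=
  ⨅ (t : ℝ) (_ : 0 ≤ t ∧ ∃ q ∈ F, u = t • q), ENNReal.ofReal t

/-- Enlargement `Ω_r = {x : T(x) ≤ r}` of the target set. -/
noncomputable def enl [NormedAddCommGroup X] [NormedSpace ℝ X]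
    (Ω F : Set X) (r : ℝ) : Set X :=
  {x | mtime Ω F x ≤ ENNReal.ofReal r}

/-- Generalized (minimal time) projection `Π(x) = (x + T(x)·F) ∩ Ω`. -/
noncomputable def mproj [NormedAddCommGroup X] [NormedSpace ℝ X]
    (Ω F : Set X) (x : X) : Set X :=
  {w | w ∈ Ω ∧ ∃ q ∈ F, w = x + (mtime Ω F x).toReal • q}

/-- Support function `σ_F(x*) = sup_{q ∈ F} ⟨x*, q⟩`. -/
noncomputable def suppFn [NormedAddCommGroup X] [NormedSpace ℝ X]
    (F : Set X) (p : X →L[ℝ] ℝ) : ℝ :=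
  sSup ((fun q => p q) '' F)

/-- Dynamics bound `‖F‖ = sup{‖q‖ : q ∈ F}`. -/
noncomputable def dynBound [NormedAddCommGroup X] (F : Set X) : ℝ :=
  sSup ((fun q => ‖q‖) '' F)

/-- Fréchet `ε`-subdifferential of `φ` at `xb`:
`liminf_{x→xb} (φ(x) − φ(xb) − ⟨x*, x−xb⟩)/‖x−xb‖ ≥ −ε`. -/
def fsub [NormedAddCommGroup X] [NormedSpace ℝ X]
    (φ : X → ℝ≥0∞) (ε : ℝ) (xb : X) : Set (X →L[ℝ] ℝ) :=
  {p | ∀ γ > (0:ℝ), ∃ δ > (0:ℝ), ∀ x, ‖x - xb‖ < δ →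
    ENNReal.ofReal ((φ xb).toReal + p (x - xb) - (ε + γ) * ‖x - xb‖) ≤ φ x}

/-- Set of `ε`-normals to `Θ` at `xb ∈ Θ`. -/
def enormal [NormedAddCommGroup X] [NormedSpace ℝ X]
    (Θ : Set X) (ε : ℝ) (xb : X) : Set (X →L[ℝ] ℝ) :=
  {p | ∀ γ > (0:ℝ), ∃ δ > (0:ℝ), ∀ x ∈ Θ, ‖x - xb‖ < δ →
    p (x - xb) ≤ (ε + γ) * ‖x - xb‖}

/-- Basic (limiting/Mordukhovich) normal cone. -/
def bnormal [NormedAddCommGroup X] [NormedSpace ℝ X]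
    (Θ : Set X) (xb : X) : Set (X →L[ℝ] ℝ) :=
  {p | ∃ (ε : ℕ → ℝ) (x : ℕ → X) (ps : ℕ → X →L[ℝ] ℝ),
    (∀ k, 0 ≤ ε k) ∧ Tendsto ε atTop (𝓝 0) ∧
    (∀ k, x k ∈ Θ) ∧ Tendsto x atTop (𝓝 xb) ∧
    (∀ k, ps k ∈ enormal Θ (ε k) (x k)) ∧
    (∀ v, Tendsto (fun k => ps k v) atTop (𝓝 (p v)))}

/-- Basic (limiting/Mordukhovich) subdifferential. -/
def bsub [NormedAddCommGroup X] [NormedSpace ℝ X]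
    (φ : X → ℝ≥0∞) (xb : X) : Set (X →L[ℝ] ℝ) :=
  {p | ∃ (ε : ℕ → ℝ) (x : ℕ → X) (ps : ℕ → X →L[ℝ] ℝ),
    (∀ k, 0 ≤ ε k) ∧ Tendsto ε atTop (𝓝 0) ∧
    Tendsto x atTop (𝓝 xb) ∧
    Tendsto (fun k => φ (x k)) atTop (𝓝 (φ xb)) ∧
    (∀ k, ps k ∈ fsub φ (ε k) (x k)) ∧
    (∀ v, Tendsto (fun k => ps k v) atTop (𝓝 (p v)))}

/-- Singular (Mordukhovich) subdifferential. -/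
def ssub [NormedAddCommGroup X] [NormedSpace ℝ X]
    (φ : X → ℝ≥0∞) (xb : X) : Set (X →L[ℝ] ℝ) :=
  {p | ∃ (ε lam : ℕ → ℝ) (x : ℕ → X) (ps : ℕ → X →L[ℝ] ℝ),
    (∀ k, 0 ≤ ε k) ∧ Tendsto ε atTop (𝓝 0) ∧
    (∀ k, 0 < lam k) ∧ Tendsto lam atTop (𝓝 0) ∧
    Tendsto x atTop (𝓝 xb) ∧
    Tendsto (fun k => φ (x k)) atTop (𝓝 (φ xb)) ∧
    (∀ k, ps k ∈ fsub φ (ε k) (x k)) ∧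
    (∀ v, Tendsto (fun k => lam k * ps k v) atTop (𝓝 (p v)))}

/-- Subdifferential of convex analysis (for `ℝ≥0∞`-valued convex functions,
finite at the reference point). -/
def csub [NormedAddCommGroup X] [NormedSpace ℝ X]
    (φ : X → ℝ≥0∞) (xb : X) : Set (X →L[ℝ] ℝ) :=
  {p | ∀ x, ENNReal.ofReal (p (x - xb) + (φ xb).toReal) ≤ φ x}

/-- Normal cone of convex analysis. -/
def cnormal [NormedAddCommGroup X] [NormedSpace ℝ X]
    (Θ : Set X) (xb : X) : Set (X →L[ℝ] ℝ) :=
  {p | ∀ x ∈ Θ, p (x - xb) ≤ 0}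

theorem norm_le_dynBound [NormedAddCommGroup X] {F : Set X} {q : X}
    (hF : Bornology.IsBounded F) (hq : q ∈ F) : ‖q‖ ≤ dynBound F := by
  obtain ⟨C, hC⟩ := hF.exists_norm_le
  exact le_csSup ⟨C, forall_mem_image.mpr hC⟩ (mem_image_of_mem _ hq)

section MinimalTime

variable [NormedAddCommGroup X] [NormedSpace ℝ X] {Ω F : Set X} {x q : X}

theorem mtime_le_ofReal {t : ℝ} (ht : 0 ≤ t) (hq : q ∈ F) (h : x + t • q ∈ Ω) :
    mtime Ω F x ≤ ENNReal.ofReal t :=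
  iInf₂_le t ⟨ht, q, hq, h⟩

theorem exists_add_smul_mem_of_mtime_lt {r : ℝ} (h : mtime Ω F x < ENNReal.ofReal r) :
    ∃ s, 0 ≤ s ∧ s < r ∧ ∃ q ∈ F, x + s • q ∈ Ω := by
  simp only [mtime, iInf_lt_iff] at h
  obtain ⟨s, ⟨hs, q, hq, hmem⟩, hlt⟩ := h
  exact ⟨s, hs, (ENNReal.ofReal_lt_ofReal_iff_of_nonneg hs).mp hlt, q, hq, hmem⟩

theorem exists_add_smul_mem_of_toReal_mtime_lt {r : ℝ} (hfin : mtime Ω F x ≠ ⊤)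
    (h : (mtime Ω F x).toReal < r) :
    ∃ s, 0 ≤ s ∧ s < r ∧ ∃ q ∈ F, x + s • q ∈ Ω :=
  exists_add_smul_mem_of_mtime_lt ((ENNReal.lt_ofReal_iff_toReal_lt hfin).mpr h)

theorem toReal_mtime_le {s : ℝ} (hs : 0 ≤ s) (hq : q ∈ F) (h : x + s • q ∈ Ω) :
    (mtime Ω F x).toReal ≤ s :=
  ENNReal.toReal_le_of_le_ofReal hs (mtime_le_ofReal hs hq h)

theorem apply_le_suppFn (hF : Bornology.IsBounded F) (p : X →L[ℝ] ℝ) (hq : q ∈ F) :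
    p q ≤ suppFn F p := by
  obtain ⟨C, hC⟩ := hF.exists_norm_le
  refine le_csSup ⟨‖p‖ * C, forall_mem_image.mpr fun y hy => ?_⟩ (mem_image_of_mem _ hq)
  exact (le_abs_self _).trans (p.le_opNorm_of_le (hC y hy))

/-- Moving backwards along the dynamics for time `t` increases the minimal time by at most `t`. -/
theorem mtime_sub_smul_le (hF : Convex ℝ F) {t : ℝ} (ht : 0 ≤ t) (hq : q ∈ F) :
    mtime Ω F (x - t • q) ≤ ENNReal.ofReal t + mtime Ω F x := by
  simp only [mtime, ENNReal.add_iInf]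
  refine le_iInf₂ fun s ⟨hs, q', hq', hmem⟩ => ?_
  rw [← ENNReal.ofReal_add ht hs]
  obtain ⟨y, hy, hyeq⟩ : t • q + s • q' ∈ (t + s) • F := by
    rw [hF.add_smul ht hs]
    exact add_mem_add (smul_mem_smul_set hq) (smul_mem_smul_set hq')
  refine mtime_le_ofReal (add_nonneg ht hs) hy ?_
  convert hmem using 1
  change (t + s) • y = _ at hyeq
  rw [hyeq]
  abel

theorem toReal_mtime_pos (hΩ : IsClosed Ω) (hF : Bornology.IsBounded F) (hx : x ∉ Ω)
    (hfin : mtime Ω F x ≠ ⊤) : 0 < (mtime Ω F x).toReal := by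
  by_contra! hle
  obtain ⟨C, hC, hFC⟩ := hF.exists_pos_norm_le
  refine hx (hΩ.closure_subset (Metric.mem_closure_iff.mpr fun η hη => ?_))
  obtain ⟨s, hs, hsη, q, hq, hmem⟩ :=
    exists_add_smul_mem_of_toReal_mtime_lt hfin (hle.trans_lt (div_pos hη hC))
  refine ⟨_, hmem, ?_⟩
  rw [dist_self_add_right, norm_smul, Real.norm_of_nonneg hs]
  calc s * ‖q‖ ≤ s * C := by gcongr; exact hFC q hq
    _ < η := (lt_div_iff₀ hC).mp hsη

theorem neg_apply_le_of_mem_fsub_mtime (hF : Convex ℝ F) (hfin : mtime Ω F x ≠ ⊤) {ε : ℝ}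
    {p : X →L[ℝ] ℝ} (hp : p ∈ fsub (mtime Ω F) ε x) (hq : q ∈ F) :
    -p q ≤ 1 + ε * ‖q‖ := by
  have key : ∀ γ > (0 : ℝ), -p q ≤ 1 + (ε + γ) * ‖q‖ := by
    intro γ hγ
    obtain ⟨δ, hδ, h⟩ := hp γ hγ
    obtain ⟨t, ht, htδ⟩ := exists_pos_mul_lt hδ ‖q‖
    have hnorm : ‖x - t • q - x‖ = t * ‖q‖ := by
      rw [sub_sub_cancel_left, norm_neg, norm_smul, Real.norm_of_nonneg ht.le]
    have hle := (h (x - t • q) (by rw [hnorm]; linarith)).trans (mtime_sub_smul_le hF ht.le hq)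
    rw [hnorm, ← ENNReal.ofReal_toReal hfin, ← ENNReal.ofReal_add ht.le ENNReal.toReal_nonneg,
      ENNReal.ofReal_le_ofReal_iff (by positivity), ENNReal.ofReal_toReal hfin,
      sub_sub_cancel_left, map_neg, map_smul, smul_eq_mul] at hle
    refine le_of_mul_le_mul_left ?_ ht
    linarith
  have hlim : Tendsto (fun γ : ℝ => 1 + (ε + γ) * ‖q‖) (𝓝[>] 0) (𝓝 (1 + (ε + 0) * ‖q‖)) :=
    (Continuous.tendsto (by fun_prop) 0).mono_left nhdsWithin_le_nhds
  rw [add_zero] at hlim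
  exact ge_of_tendsto hlim (eventually_mem_nhdsWithin.mono key)

theorem one_sub_le_suppFn_neg_of_mem_fsub_mtime (hΩ : IsClosed Ω) (hF : Bornology.IsBounded F)
    (hx : x ∉ Ω) (hfin : mtime Ω F x ≠ ⊤) {ε : ℝ} (hε : 0 ≤ ε) {p : X →L[ℝ] ℝ}
    (hp : p ∈ fsub (mtime Ω F) ε x) :
    1 - ε * dynBound F ≤ suppFn F (-p) := by
  have hT := toReal_mtime_pos hΩ hF hx hfin
  obtain ⟨C, hC, hFC⟩ := hF.exists_pos_norm_le
  have key : ∀ γ > (0 : ℝ), 1 - γ - (ε + γ) * dynBound F ≤ suppFn F (-p) := by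
    intro γ hγ
    obtain ⟨δ, hδ, h⟩ := hp γ hγ
    obtain ⟨t₀, ht₀, ht₀δ⟩ := exists_pos_mul_lt hδ C
    obtain ⟨t, ht, htmin⟩ : ∃ t > 0, t ≤ min t₀ (mtime Ω F x).toReal :=
      ⟨_, lt_min ht₀ hT, le_rfl⟩
    obtain ⟨s, hs, hsT, q, hq, hmem⟩ :=
      exists_add_smul_mem_of_toReal_mtime_lt hfin (lt_add_of_pos_right _ (mul_pos ht hγ))
    have hts : t ≤ s := (htmin.trans (min_le_right _ _)).trans (toReal_mtime_le hs hq hmem)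
    have hnorm : ‖x + t • q - x‖ = t * ‖q‖ := by
      rw [add_sub_cancel_left, norm_smul, Real.norm_of_nonneg ht.le]
    have hnear : ‖x + t • q - x‖ < δ := by
      calc ‖x + t • q - x‖ = t * ‖q‖ := hnorm
        _ ≤ t₀ * C := mul_le_mul (htmin.trans (min_le_left _ _)) (hFC q hq)
            (norm_nonneg q) ht₀.le
        _ < δ := by rwa [mul_comm]
    have hmem' : x + t • q + (s - t) • q ∈ Ω := by
      rwa [add_assoc, ← add_smul, add_sub_cancel]
    have hle := (h _ hnear).trans (mtime_le_ofReal (sub_nonneg.mpr hts) hq hmem')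
    rw [ENNReal.ofReal_le_ofReal_iff (sub_nonneg.mpr hts), hnorm, add_sub_cancel_left, map_smul,
      smul_eq_mul] at hle
    have hdir : 1 - γ - (ε + γ) * ‖q‖ ≤ (-p) q := by
      rw [neg_apply]
      refine le_of_mul_le_mul_left ?_ ht
      linarith
    have hbound : (ε + γ) * ‖q‖ ≤ (ε + γ) * dynBound F := by
      gcongr
      exact norm_le_dynBound hF hq
    linarith [apply_le_suppFn hF (-p) hq]
  have hlim : Tendsto (fun γ : ℝ => 1 - γ - (ε + γ) * dynBound F) (𝓝[>] 0)
      (𝓝 (1 - 0 - (ε + 0) * dynBound F)) :=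
    (Continuous.tendsto (by fun_prop) 0).mono_left nhdsWithin_le_nhds
  rw [add_zero, sub_zero] at hlim
  exact le_of_tendsto hlim (eventually_mem_nhdsWithin.mono key)

end MinimalTime

/-- Proposition 4.4: relationship between dynamics and `ε`-subgradients of
minimal time functions at out-of-set points:
`1 − ε‖F‖ ≤ σ_F(−x*) ≤ 1 + ε‖F‖` for every `x* ∈ ∂̂_ε T(x̄)`. -/
theorem suppFn_bounds_of_fsub_mtime [NormedAddCommGroup X] [NormedSpace ℝ X]
    [CompleteSpace X]
    (Ω F : Set X) (hΩne : Ω.Nonempty) (hΩcl : IsClosed Ω)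
    (hFne : F.Nonempty) (hFcl : IsClosed F) (hFbd : Bornology.IsBounded F)
    (hFcv : Convex ℝ F)
    (xb : X) (hxb : xb ∉ Ω) (hfin : mtime Ω F xb < ⊤)
    (ε : ℝ) (hε : 0 ≤ ε) (p : X →L[ℝ] ℝ) (hp : p ∈ fsub (mtime Ω F) ε xb) :
    1 - ε * dynBound F ≤ suppFn F (-p) ∧ suppFn F (-p) ≤ 1 + ε * dynBound F := by
  refine ⟨one_sub_le_suppFn_neg_of_mem_fsub_mtime hΩcl hFbd hxb hfin.ne hε hp, ?_⟩
  refine csSup_le (hFne.image _) (forall_mem_image.mpr fun q hq => ?_)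
  have hle := neg_apply_le_of_mem_fsub_mtime hFcv hfin.ne hp hq
  have hbound := mul_le_mul_of_nonneg_left (norm_le_dynBound hFbd hq) hε
  rw [neg_apply]
  linarith
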